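/- Let G be a finite simple graph and let k ≥ 0 be an integer. Define M₀ = ∅, and for each i = 0, 1, …, k, let P*_{i+1} be any maximal (with respect to set inclusion) collection of pairwise vertex-disjoint M_i-augmenting paths of length 2i+1, and set M_{i+1} = M_i ⊕ E(P*_{i+1}). Then for every 0 ≤ i ≤ k+1, the edge set M_i is a matching in G and every M_i-augmenting path in G has length at least 2i + 1. -/

import Mathlib

/-- `M` is a matching in `G`: a set of edges of `G`, no two of which share an endpoint. -/
def IsEdgeMatching {V : Type*} (G : SimpleGraph V) (M : Set (Sym2 V)) : Prop :=
  M ⊆ G.edgeSet ∧ ∀ e ∈ M, ∀ f ∈ M, e ≠ f → ∀ x : V, ¬(x ∈ e ∧ x ∈ f)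

/-- A walk `p` from `u` to `v` is an `M`-augmenting path: it is a path with distinct
endpoints, its edges alternate between edges of `M` and edges not in `M`, and both of
its endpoints are `M`-free. -/
def IsAugPath {V : Type*} {G : SimpleGraph V} (M : Set (Sym2 V)) {u v : V}
    (p : G.Walk u v) : Prop :=
  p.IsPath ∧ u ≠ v ∧
    List.Chain' (fun e f => ¬(e ∈ M ↔ f ∈ M)) p.edges ∧
    (∀ e ∈ M, u ∉ e) ∧ (∀ e ∈ M, v ∉ e)

/-- A walk in `G` bundled together with its endpoints. -/
abbrev PathSig {V : Type*} (G : SimpleGraph V) := Σ u : V, Σ v : V, G.Walk u v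

/-- Two bundled walks are vertex-disjoint: they share no vertex. -/
def VDisj {V : Type*} {G : SimpleGraph V} (p q : PathSig G) : Prop :=
  ∀ x : V, x ∈ p.2.2.support → x ∉ q.2.2.support

/-- The set of edges appearing in a collection of bundled walks. -/
def pathsEdges {V : Type*} {G : SimpleGraph V} (P : Set (PathSig G)) : Set (Sym2 V) :=
  {e | ∃ p ∈ P, e ∈ p.2.2.edges}

/-- Some edge of `M` contains `x`. -/
def IsCovered {V : Type*} (M : Set (Sym2 V)) (x : V) : Prop := ∃ e ∈ M, x ∈ e

theorem IsEdgeMatching.eq_of_mem {V : Type*} {G : SimpleGraph V} {M : Set (Sym2 V)}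
    (hM : IsEdgeMatching G M) {e f : Sym2 V} {x : V} (he : e ∈ M) (hf : f ∈ M)
    (hxe : x ∈ e) (hxf : x ∈ f) : e = f := by
  by_contra hne
  exact hM.2 e he f hf hne x ⟨hxe, hxf⟩

theorem IsEdgeMatching.mono {V : Type*} {G : SimpleGraph V} {M N : Set (Sym2 V)}
    (hM : IsEdgeMatching G M) (h : N ⊆ M) : IsEdgeMatching G N :=
  ⟨h.trans hM.1, fun e he f hf => hM.2 e (h he) f (h hf)⟩

theorem isAugPath_congr {V : Type*} {G : SimpleGraph V} {M N : Set (Sym2 V)} {u v : V}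
    {p : G.Walk u v} (h : ∀ e, ∀ x ∈ p.support, x ∈ e → (e ∈ M ↔ e ∈ N)) :
    IsAugPath M p ↔ IsAugPath N p := by
  have hedge : ∀ e ∈ p.edges, (e ∈ M ↔ e ∈ N) := fun e he =>
    h e e.out.1 (SimpleGraph.Walk.mem_support_of_mem_edges he (Sym2.out_fst_mem e))
      (Sym2.out_fst_mem e)
  have hchain : ∀ l : List (Sym2 V), (∀ e ∈ l, (e ∈ M ↔ e ∈ N)) →
      (l.IsChain (fun e f => ¬(e ∈ M ↔ f ∈ M)) ↔ l.IsChain (fun e f => ¬(e ∈ N ↔ f ∈ N))) := by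
    intro l hl
    simp only [List.isChain_iff_getElem]
    refine forall₂_congr fun i hi => ?_
    rw [hl _ (List.getElem_mem _), hl _ (List.getElem_mem _)]
  have hfree : ∀ x ∈ p.support, ((∀ e ∈ M, x ∉ e) ↔ (∀ e ∈ N, x ∉ e)) := fun x hx =>
    ⟨fun H e he hxe => H e ((h e x hx hxe).2 he) hxe,
      fun H e he hxe => H e ((h e x hx hxe).1 he) hxe⟩
  unfold IsAugPath
  rw [hfree u p.start_mem_support, hfree v p.end_mem_support]
  exact and_congr_right fun _ => and_congr_right fun _ => and_congr (hchain _ hedge) Iff.rfl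

theorem IsEdgeMatching.ncard_setOf_isCovered {V : Type*} [Finite V] {G : SimpleGraph V}
    {M : Set (Sym2 V)} (hM : IsEdgeMatching G M) : {x | IsCovered M x}.ncard = 2 * M.ncard := by
  classical
  have hfin : M.Finite := M.toFinite
  have hset : {x | IsCovered M x} = ((hfin.toFinset.biUnion Sym2.toFinset : Finset V) : Set V) := by
    ext x
    simp [IsCovered]
  rw [hset, Set.ncard_coe_finset, Finset.card_biUnion, Finset.sum_congr rfl (g := fun _ => 2),
    Finset.sum_const, Set.ncard_eq_toFinset_card M hfin, smul_eq_mul, mul_comm]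
  · intro e he
    exact Sym2.card_toFinset_of_not_isDiag _
      (G.not_isDiag_of_mem_edgeSet (hM.1 (hfin.mem_toFinset.1 he)))
  · intro e he f hf hne
    refine Finset.disjoint_left.2 fun x hxe hxf => ?_
    exact hM.2 e (by simpa using he) f (by simpa using hf) hne x
      ⟨Sym2.mem_toFinset.1 hxe, Sym2.mem_toFinset.1 hxf⟩

/-- If every `M`-augmenting path has at least `L` edges, `A` and `B` are matchings outside and
inside `M`, and the alternating components of `A ∪ B` are complete with respect to `M`, then
`A ∪ B` has at least `L` edges for each unit of excess of `A` over `B`. The second and third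
parts account for an `M`-alternating path `q` already detached from `A ∪ B`, ending in an edge
of `M`, respectively in an edge outside `M`. -/
theorem ncard_mul_le_of_alternating {V : Type*} [Finite V] {G : SimpleGraph V}
    {M : Set (Sym2 V)} {L : ℕ}
    (hL : ∀ (u v : V) (p : G.Walk u v), IsAugPath M p → L ≤ p.length) (n : ℕ) :
    ∀ A B : Set (Sym2 V), A.ncard + B.ncard ≤ n → IsEdgeMatching G A → IsEdgeMatching G B →
      (∀ e ∈ A, e ∉ M) → B ⊆ M →
      ((∀ x, IsCovered A x → IsCovered M x → IsCovered B x) →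
        A.ncard * L ≤ B.ncard * L + A.ncard + B.ncard) ∧
      (∀ (u v : V) (q : G.Walk v u), q.IsPath →
        q.edges.IsChain (fun e f => ¬(e ∈ M ↔ f ∈ M)) → (∀ e ∈ q.edges.head?, e ∈ M) →
        ¬IsCovered M u → ¬IsCovered B v →
        (∀ x ∈ q.support, x ≠ v → ¬IsCovered A x ∧ ¬IsCovered B x) →
        (∀ x, x ≠ v → IsCovered A x → IsCovered M x → IsCovered B x) →
        A.ncard * L ≤ B.ncard * L + A.ncard + B.ncard + q.length) ∧
      (∀ (u v : V) (q : G.Walk v u), q.IsPath → v ≠ u →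
        q.edges.IsChain (fun e f => ¬(e ∈ M ↔ f ∈ M)) → (∀ e ∈ q.edges.head?, e ∉ M) →
        ¬IsCovered M u → ¬IsCovered A v →
        (∀ x ∈ q.support, x ≠ v → ¬IsCovered A x ∧ ¬IsCovered B x) →
        (∀ x, x ≠ v → IsCovered A x → IsCovered M x → IsCovered B x) →
        (IsCovered M v → IsCovered B v) →
        (A.ncard + 1) * L ≤ B.ncard * L + A.ncard + B.ncard + q.length) := by
  induction n using Nat.strong_induction_on with
  | _ n ih =>
  intro A B hn hA hB hAM hBM
  have hdiff : ∀ (C : Set (Sym2 V)) (e : Sym2 V), IsEdgeMatching G C → e ∈ C →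
      ∀ x, IsCovered (C \ {e}) x ↔ IsCovered C x ∧ x ∉ e := by
    intro C e hC he x
    constructor
    · rintro ⟨f, ⟨hf, hfe⟩, hx⟩
      exact ⟨⟨f, hf, hx⟩, fun hxe => hfe (hC.eq_of_mem hf he hx hxe)⟩
    · rintro ⟨⟨f, hf, hx⟩, hxe⟩
      exact ⟨f, ⟨hf, fun h => hxe (h ▸ hx)⟩, hx⟩
  -- extending a detached path by an edge of `A`
  have stepA : ∀ (u v w : V) (q : G.Walk v u), q.IsPath →
      q.edges.IsChain (fun e f => ¬(e ∈ M ↔ f ∈ M)) → (∀ e ∈ q.edges.head?, e ∈ M) →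
      ¬IsCovered M u → ¬IsCovered B v →
      (∀ x ∈ q.support, x ≠ v → ¬IsCovered A x ∧ ¬IsCovered B x) →
      (∀ x, x ≠ v → IsCovered A x → IsCovered M x → IsCovered B x) → s(v, w) ∈ A →
      A.ncard * L ≤ B.ncard * L + A.ncard + B.ncard + q.length := by
    intro u v w q hq hch hhd hu hvB hsupp hcl he
    have hadj : G.Adj v w := hA.1 he
    have hcard := Set.ncard_sdiff_singleton_add_one he
    have hw : w ∉ q.support := fun hw =>
      (hsupp w hw hadj.ne').1 ⟨_, he, Sym2.mem_mk_right v w⟩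
    have hd := hdiff A _ hA he
    have := (ih (n - 1) (by omega) (A \ {s(v, w)}) B (by omega) (hA.mono Set.sdiff_subset) hB
      (fun e h => hAM e h.1) hBM).2.2 u w (SimpleGraph.Walk.cons hadj.symm q)
      ((SimpleGraph.Walk.cons_isPath_iff _ _).2 ⟨hq, hw⟩)
      (fun h => hw (h ▸ q.end_mem_support))
      (by
        rw [SimpleGraph.Walk.edges_cons, List.isChain_cons]
        refine ⟨fun e' he' h => hAM _ he ?_, hch⟩
        rw [Sym2.eq_swap]
        exact h.2 (hhd e' he'))
      (by
        simp only [SimpleGraph.Walk.edges_cons, List.head?_cons, Option.mem_some_iff]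
        rintro e rfl
        rw [Sym2.eq_swap]
        exact hAM _ he)
      hu (by rw [hd]; simp)
      (by
        intro x hx hxw
        rw [SimpleGraph.Walk.support_cons, List.mem_cons] at hx
        rw [hd]
        rcases eq_or_ne x v with rfl | hxv
        · exact ⟨by simp, hvB⟩
        · have := hsupp x (hx.resolve_left hxw) hxv
          exact ⟨fun h => this.1 h.1, this.2⟩)
      (by
        intro x _ hxA hxM
        rw [hd] at hxA
        exact hcl x (fun h => hxA.2 (by simp [h])) hxA.1 hxM)
      (fun h => hcl w hadj.ne' ⟨_, he, Sym2.mem_mk_right v w⟩ h)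
    rw [hcard, SimpleGraph.Walk.length_cons] at this
    omega
  have closed : (∀ x, IsCovered A x → IsCovered M x → IsCovered B x) →
      A.ncard * L ≤ B.ncard * L + A.ncard + B.ncard := by
    intro hcl
    rcases le_or_gt A.ncard B.ncard with hle | hlt
    · have := Nat.mul_le_mul_right L hle
      omega
    have hsub : ¬{x | IsCovered A x} ⊆ {x | IsCovered B x} := fun h => by
      have := Set.ncard_le_ncard h
      rw [hA.ncard_setOf_isCovered, hB.ncard_setOf_isCovered] at this
      omega
    obtain ⟨u, ⟨e, he, w, rfl⟩, huB⟩ := Set.not_subset.1 hsub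
    exact stepA u u w SimpleGraph.Walk.nil (by simp) (by simp) (by simp)
      (fun h => huB (hcl u ⟨_, he, Sym2.mem_mk_left u w⟩ h)) huB
      (by simp) (fun x _ => hcl x) he
  refine ⟨closed, ?_, ?_⟩
  · intro u v q hq hch hhd hu hvB hsupp hcl
    by_cases hvA : IsCovered A v
    · obtain ⟨e, he, w, rfl⟩ := hvA
      exact stepA u v w q hq hch hhd hu hvB hsupp hcl he
    · have := closed fun x hxA => hcl x (fun h => hvA (h ▸ hxA)) hxA
      omega
  · intro u v q hq hne hch hhd hu hvA hsupp hcl hv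
    by_cases hvB : IsCovered B v
    · obtain ⟨f, hf, w, rfl⟩ := hvB
      have hadj : G.Adj v w := hB.1 hf
      have hcard := Set.ncard_sdiff_singleton_add_one hf
      have hw : w ∉ q.support := fun hw =>
        (hsupp w hw hadj.ne').2 ⟨_, hf, Sym2.mem_mk_right v w⟩
      have hd := hdiff B _ hB hf
      have := (ih (n - 1) (by omega) A (B \ {s(v, w)}) (by omega) hA (hB.mono Set.sdiff_subset)
        hAM (Set.sdiff_subset.trans hBM)).2.1 u w (SimpleGraph.Walk.cons hadj.symm q)
        ((SimpleGraph.Walk.cons_isPath_iff _ _).2 ⟨hq, hw⟩)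
        (by
          rw [SimpleGraph.Walk.edges_cons, List.isChain_cons]
          refine ⟨fun e' he' h => hhd e' he' (h.1 ?_), hch⟩
          rw [Sym2.eq_swap]
          exact hBM hf)
        (by
          simp only [SimpleGraph.Walk.edges_cons, List.head?_cons, Option.mem_some_iff]
          rintro e rfl
          rw [Sym2.eq_swap]
          exact hBM hf)
        hu (by rw [hd]; simp)
        (by
          intro x hx hxw
          rw [SimpleGraph.Walk.support_cons, List.mem_cons] at hx
          rw [hd]
          rcases eq_or_ne x v with rfl | hxv
          · exact ⟨hvA, by simp⟩
          · have := hsupp x (hx.resolve_left hxw) hxv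
            exact ⟨this.1, fun h => this.2 h.1⟩)
        (by
          intro x hxw hxA hxM
          have hxv : x ≠ v := fun h => hvA (h ▸ hxA)
          rw [hd]
          exact ⟨hcl x hxv hxA hxM, by simp [hxv, hxw]⟩)
      rw [← hcard, Nat.add_mul, Nat.add_mul]
      rw [SimpleGraph.Walk.length_cons] at this
      omega
    · have h1 := closed fun x hxA => hcl x (fun h => hvA (h ▸ hxA)) hxA
      have h2 := hL v u q ⟨hq, hne, hch, fun e he hve => hvB (hv ⟨e, he, hve⟩),
        fun e he hue => hu ⟨e, he, hue⟩⟩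
      rw [Nat.add_mul]
      omega

/-- If every `M`-augmenting path has at least `L` edges, a matching `N` differs from `M` in at
least `L` edges for each unit by which it is larger. -/
theorem IsEdgeMatching.ncard_mul_le {V : Type*} [Finite V] {G : SimpleGraph V}
    {M N : Set (Sym2 V)} (hM : IsEdgeMatching G M) (hN : IsEdgeMatching G N) {L t : ℕ}
    (hL : ∀ (u v : V) (p : G.Walk u v), IsAugPath M p → L ≤ p.length)
    (hcard : N.ncard = M.ncard + t) : t * L ≤ (symmDiff M N).ncard := by
  have key := (ncard_mul_le_of_alternating hL _ (N \ M) (M \ N) le_rfl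
    (hN.mono Set.sdiff_subset) (hM.mono Set.sdiff_subset) (fun e he => he.2) Set.sdiff_subset).1
    (by
      rintro x ⟨e, he, hxe⟩ ⟨f, hf, hxf⟩
      refine ⟨f, ⟨hf, fun hfN => he.2 ?_⟩, hxf⟩
      rwa [hN.eq_of_mem he.1 hfN hxe hxf])
  have h1 := Set.ncard_inter_add_ncard_sdiff_eq_ncard N M
  have h2 := Set.ncard_inter_add_ncard_sdiff_eq_ncard M N
  rw [Set.inter_comm] at h2
  have h3 : (symmDiff M N).ncard = (M \ N).ncard + (N \ M).ncard :=
    Set.ncard_union_eq (disjoint_sdiff_sdiff)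
  have h4 : (N \ M).ncard = (M \ N).ncard + t := by omega
  rw [h4, Nat.add_mul] at key
  omega

/-- Augmenting a matching `M` along an augmenting path `p` gives a matching with one more edge.
Moreover `p` has odd length, every vertex of `p` lies on an edge of `p` outside `M`, and `p`
contains every edge of `M` that meets it. -/
theorem IsAugPath.augment {V : Type*} [Finite V] {G : SimpleGraph V} (n : ℕ) :
    ∀ {M : Set (Sym2 V)} {u v : V} {p : G.Walk u v}, p.length ≤ n → IsEdgeMatching G M →
      IsAugPath M p →
      IsEdgeMatching G (symmDiff M {e | e ∈ p.edges}) ∧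
      (symmDiff M {e | e ∈ p.edges}).ncard = M.ncard + 1 ∧
      Odd p.length ∧
      (∀ x ∈ p.support, ∃ e ∈ p.edges, e ∉ M ∧ x ∈ e) ∧
      (∀ e ∈ M, ∀ x ∈ p.support, x ∈ e → e ∈ p.edges) := by
  induction n using Nat.strong_induction_on with
  | _ n ih =>
  intro M u v p hn hM hp
  obtain ⟨hpath, hne, hch, hu, hv⟩ := hp
  match p with
  | .nil => exact absurd rfl hne
  | .cons hadj .nil =>
    have he : s(u, v) ∉ M := fun h => hu _ h (Sym2.mem_mk_left u v)
    have hs : symmDiff M {e | e ∈ (SimpleGraph.Walk.cons hadj .nil).edges}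
        = insert s(u, v) M := by
      ext e
      simp only [Set.mem_symmDiff, SimpleGraph.Walk.edges_cons, SimpleGraph.Walk.edges_nil,
        List.mem_singleton, Set.mem_ofPred_eq, Set.mem_insert_iff]
      by_cases h : e = s(u, v)
      · simp [h, he]
      · simp [h]
    rw [hs]
    refine ⟨⟨Set.insert_subset hadj hM.1, ?_⟩, Set.ncard_insert_of_notMem he, by simp, ?_, ?_⟩
    · have hfree : ∀ f ∈ M, ∀ x, ¬(x ∈ s(u, v) ∧ x ∈ f) := by
        rintro f hf x ⟨hx, hxf⟩
        rcases Sym2.mem_iff.1 hx with rfl | rfl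
        · exact hu f hf hxf
        · exact hv f hf hxf
      rintro e (rfl | he') f (rfl | hf) hef x hx
      · exact hef rfl
      · exact hfree f hf x hx
      · exact hfree e he' x hx.symm
      · exact hM.2 e he' f hf hef x hx
    · intro x hx
      exact ⟨s(u, v), by simp, he, by simpa using hx⟩
    · intro e he' x hx hxe
      simp only [SimpleGraph.Walk.support_cons, SimpleGraph.Walk.support_nil, List.mem_cons,
        List.not_mem_nil, or_false] at hx
      rcases hx with rfl | rfl
      · exact absurd hxe (hu e he')
      · exact absurd hxe (hv e he')
  | .cons (v := w) hadj (.cons (v := y) hadj' r) =>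
    have he : s(u, w) ∉ M := fun h => hu _ h (Sym2.mem_mk_left u w)
    simp only [SimpleGraph.Walk.edges_cons] at hch
    have hch' : List.IsChain (fun e f => ¬(e ∈ M ↔ f ∈ M)) (s(u, w) :: s(w, y) :: r.edges) := hch
    rw [List.isChain_cons_cons] at hch'
    have hf : s(w, y) ∈ M := by
      have := hch'.1
      tauto
    simp only [SimpleGraph.Walk.cons_isPath_iff, SimpleGraph.Walk.support_cons, List.mem_cons,
      not_or] at hpath
    obtain ⟨⟨hr, hwr⟩, huw, hur⟩ := hpath
    have hyr := r.start_mem_support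
    have hvr := r.end_mem_support
    have her : ∀ x ∈ r.support, x ∉ s(u, w) := by
      rintro x hx hxe
      rcases Sym2.mem_iff.1 hxe with rfl | rfl
      · exact hur hx
      · exact hwr hx
    have hfr : ∀ x ∈ r.support, x ∈ s(w, y) → x = y := by
      rintro x hx hxe
      exact (Sym2.mem_iff.1 hxe).resolve_left fun h => hwr (h ▸ hx)
    have her' : s(u, w) ∉ r.edges := fun h => hwr (r.snd_mem_support_of_mem_edges h)
    have hfr' : s(w, y) ∉ r.edges := fun h => hwr (r.fst_mem_support_of_mem_edges h)
    have hef : s(u, w) ≠ s(w, y) := fun h => he (h ▸ hf)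
    have hvy : y ≠ v := fun h => hv _ hf (h ▸ Sym2.mem_mk_right w y)
    set M₁ := insert s(u, w) (M \ {s(w, y)}) with hM₁
    have hM₁m : IsEdgeMatching G M₁ := by
      have hfree : ∀ f ∈ M \ {s(w, y)}, ∀ x, ¬(x ∈ s(u, w) ∧ x ∈ f) := by
        rintro f ⟨hfM, hff⟩ x ⟨hx, hxf⟩
        rcases Sym2.mem_iff.1 hx with rfl | rfl
        · exact hu f hfM hxf
        · exact hff (hM.eq_of_mem hfM hf hxf (Sym2.mem_mk_left _ _))
      refine ⟨Set.insert_subset hadj (Set.sdiff_subset.trans hM.1), ?_⟩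
      rintro e (rfl | he') f (rfl | hf') hef x hx
      · exact hef rfl
      · exact hfree f hf' x hx
      · exact hfree e he' x hx.symm
      · exact hM.2 e he'.1 f hf'.1 hef x hx
    have hcard : M₁.ncard = M.ncard := Set.ncard_exchange he hf
    have hedge : ∀ e ∈ r.edges, (e ∈ M ↔ e ∈ M₁) := by
      intro e her''
      have h1 : e ≠ s(u, w) := fun h => her' (h ▸ her'')
      have h2 : e ≠ s(w, y) := fun h => hfr' (h ▸ her'')
      simp [hM₁, h1, h2]
    have haug : IsAugPath M₁ r := by
      refine ⟨hr, hvy, ?_, ?_, ?_⟩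
      · have hc := (List.isChain_cons.1 hch'.2).2
        change List.IsChain _ _
        rw [List.isChain_iff_getElem] at hc ⊢
        intro i hi
        rw [← hedge _ (List.getElem_mem _), ← hedge _ (List.getElem_mem _)]
        exact hc i hi
      · rintro e (rfl | he') hy
        · exact her y hyr hy
        · exact he'.2 (hM.eq_of_mem he'.1 hf hy (Sym2.mem_mk_right w y))
      · rintro e (rfl | he') hy
        · exact her v hvr hy
        · exact hv e he'.1 hy
    have hlen : r.length + 2 ≤ n := hn
    obtain ⟨i1, i2, i3, i4, i5⟩ := ih r.length (by omega) le_rfl hM₁m haug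
    have hs : symmDiff M {e | e ∈ (SimpleGraph.Walk.cons hadj (.cons hadj' r)).edges}
        = symmDiff M₁ {e | e ∈ r.edges} := by
      ext e
      simp only [Set.mem_symmDiff, SimpleGraph.Walk.edges_cons, List.mem_cons, Set.mem_ofPred_eq,
        hM₁, Set.mem_insert_iff, Set.mem_sdiff, Set.mem_singleton_iff]
      by_cases h1 : e = s(u, w)
      · subst h1
        simp [he, her']
      by_cases h2 : e = s(w, y)
      · subst h2
        simp [hf, hfr', hef.symm]
      simp [h1, h2]
    rw [hs]
    refine ⟨i1, i2.trans (by rw [hcard]), ?_, ?_, ?_⟩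
    · simpa [Nat.odd_add, parity_simps] using i3
    · intro x hx
      simp only [SimpleGraph.Walk.support_cons, List.mem_cons] at hx
      simp only [SimpleGraph.Walk.edges_cons, List.mem_cons]
      rcases hx with rfl | rfl | hx
      · exact ⟨_, Or.inl rfl, he, Sym2.mem_mk_left _ _⟩
      · exact ⟨_, Or.inl rfl, he, Sym2.mem_mk_right _ _⟩
      · obtain ⟨e, h1, h2, h3⟩ := i4 x hx
        exact ⟨e, Or.inr (Or.inr h1), fun h => h2 ((hedge e h1).1 h), h3⟩
    · intro e he' x hx hxe
      simp only [SimpleGraph.Walk.support_cons, List.mem_cons] at hx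
      simp only [SimpleGraph.Walk.edges_cons, List.mem_cons]
      rcases eq_or_ne e s(w, y) with hef' | hef'
      · exact Or.inr (Or.inl hef')
      rcases hx with rfl | rfl | hx
      · exact absurd hxe (hu e he')
      · exact absurd (hM.eq_of_mem he' hf hxe (Sym2.mem_mk_left _ _)) hef'
      · exact Or.inr (Or.inr (i5 e (Or.inr ⟨he', hef'⟩) x hx hxe))

/-- Augmenting a matching along vertex-disjoint augmenting paths of length `L`. -/
theorem IsEdgeMatching.augment_paths {V : Type*} [Finite V] {G : SimpleGraph V}
    {M : Set (Sym2 V)} (hM : IsEdgeMatching G M) {L : ℕ} (S : Finset (PathSig G))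
    (haug : ∀ p ∈ S, IsAugPath M p.2.2 ∧ p.2.2.length = L)
    (hdisj : ∀ p ∈ S, ∀ q ∈ S, p ≠ q → VDisj p q) :
    IsEdgeMatching G (symmDiff M (pathsEdges (S : Set (PathSig G)))) ∧
      (symmDiff M (pathsEdges (S : Set (PathSig G)))).ncard = M.ncard + S.card ∧
      (pathsEdges (S : Set (PathSig G))).ncard ≤ S.card * L := by
  classical
  induction S using Finset.induction_on with
  | empty =>
    have : pathsEdges ((∅ : Finset (PathSig G)) : Set (PathSig G)) = ⊥ := by
      ext e
      simp [pathsEdges]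
    rw [this, symmDiff_bot]
    simpa using hM
  | insert p S hpS ih =>
    obtain ⟨h1, h2, h3⟩ := ih (fun q hq => haug q (Finset.mem_insert_of_mem hq))
      (fun q hq q' hq' => hdisj q (Finset.mem_insert_of_mem hq) q' (Finset.mem_insert_of_mem hq'))
    have hp := haug p (Finset.mem_insert_self p S)
    have hpe : ∀ e ∈ pathsEdges (S : Set (PathSig G)), ∀ x ∈ p.2.2.support, x ∉ e := by
      rintro e ⟨q, hq, heq⟩ x hx hxe
      exact hdisj p (Finset.mem_insert_self p S) q (Finset.mem_insert_of_mem hq)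
        (fun h => hpS (h ▸ hq)) x hx (SimpleGraph.Walk.mem_support_of_mem_edges heq hxe)
    have hset : pathsEdges ((insert p S : Finset (PathSig G)) : Set (PathSig G))
        = pathsEdges (S : Set (PathSig G)) ∪ {e | e ∈ p.2.2.edges} := by
      ext e
      simp [pathsEdges, or_comm]
    have hd : Disjoint (pathsEdges (S : Set (PathSig G))) {e | e ∈ p.2.2.edges} :=
      Set.disjoint_left.2 fun e he hep => hpe e he e.out.1
        (SimpleGraph.Walk.mem_support_of_mem_edges hep (Sym2.out_fst_mem e)) (Sym2.out_fst_mem e)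
    have hp' : IsAugPath (symmDiff M (pathsEdges (S : Set (PathSig G)))) p.2.2 := by
      refine (isAugPath_congr fun e x hx hxe => ?_).1 hp.1
      have : e ∉ pathsEdges (S : Set (PathSig G)) := fun he => hpe e he x hx hxe
      simp [Set.mem_symmDiff, this]
    obtain ⟨a1, a2, -⟩ := IsAugPath.augment _ le_rfl h1 hp'
    rw [symmDiff_assoc, hd.symmDiff_eq_sup] at a1 a2
    rw [hset, Finset.card_insert_of_notMem hpS]
    refine ⟨a1, a2.trans (by rw [h2, add_assoc]), (Set.ncard_union_le _ _).trans ?_⟩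
    have hl : {e | e ∈ p.2.2.edges}.ncard ≤ L := by
      rw [← hp.2, ← SimpleGraph.Walk.length_edges, ← List.coe_toFinset, Set.ncard_coe_finset]
      exact List.toFinset_card_le _
    rw [Nat.add_mul]
    omega

/-- Augmenting along a maximal collection of vertex-disjoint shortest augmenting paths, of length
`2 * i + 1`, yields a matching with no augmenting path shorter than `2 * i + 3`. -/
theorem IsEdgeMatching.augment_maximal {V : Type*} [Finite V] {G : SimpleGraph V}
    {M : Set (Sym2 V)} (hM : IsEdgeMatching G M) {i : ℕ} {P : Set (PathSig G)}
    (hmin : ∀ (u v : V) (p : G.Walk u v), IsAugPath M p → 2 * i + 1 ≤ p.length)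
    (haug : ∀ p ∈ P, IsAugPath M p.2.2 ∧ p.2.2.length = 2 * i + 1)
    (hdisj : ∀ p ∈ P, ∀ q ∈ P, p ≠ q → VDisj p q)
    (hmax : ∀ q : PathSig G, IsAugPath M q.2.2 → q.2.2.length = 2 * i + 1 → q ∉ P →
      ∃ p ∈ P, ¬VDisj q p) :
    IsEdgeMatching G (symmDiff M (pathsEdges P)) ∧
      ∀ (u v : V) (q : G.Walk u v), IsAugPath (symmDiff M (pathsEdges P)) q →
        2 * i + 3 ≤ q.length := by
  classical
  have hinj : Set.InjOn (fun p : PathSig G => p.1) P := by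
    intro p hp q hq h
    by_contra hne
    refine hdisj p hp q hq hne p.1 p.2.2.start_mem_support ?_
    have h' : p.1 = q.1 := h
    rw [h']
    exact q.2.2.start_mem_support
  obtain ⟨S, rfl⟩ := (Set.Finite.of_finite_image (Set.toFinite _) hinj).exists_finset_coe
  obtain ⟨h1, h2, h3⟩ := hM.augment_paths S haug hdisj
  refine ⟨h1, fun u v q hq => ?_⟩
  obtain ⟨a1, a2, a3, -, a5⟩ := IsAugPath.augment _ le_rfl h1 hq
  by_cases hmeet : ∃ p ∈ S, ¬VDisj ⟨u, v, q⟩ p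
  · obtain ⟨p, hpS, hpq⟩ := hmeet
    obtain ⟨x, hxq, hxp⟩ : ∃ x, x ∈ q.support ∧ x ∈ p.2.2.support := by
      simpa [VDisj] using hpq
    obtain ⟨e, hep, heM, hxe⟩ :=
      (IsAugPath.augment _ le_rfl hM (haug p hpS).1).2.2.2.1 x hxp
    have heP : e ∈ pathsEdges (S : Set (PathSig G)) := ⟨p, hpS, hep⟩
    have heq : e ∈ q.edges := a5 e (Or.inr ⟨heP, heM⟩) x hxq hxe
    rw [h2, add_assoc] at a2
    have key := hM.ncard_mul_le a1 hmin a2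
    rw [symmDiff_assoc, symmDiff_symmDiff_cancel_left] at key
    have hl : {e | e ∈ q.edges}.ncard ≤ q.length := by
      rw [← SimpleGraph.Walk.length_edges, ← List.coe_toFinset, Set.ncard_coe_finset]
      exact List.toFinset_card_le _
    have hsub : symmDiff (pathsEdges (S : Set (PathSig G))) {e | e ∈ q.edges} ⊆
        (pathsEdges (S : Set (PathSig G)) \ {e}) ∪ ({e | e ∈ q.edges} \ {e}) := by
      rintro f (⟨hf, hf'⟩ | ⟨hf, hf'⟩)
      · exact Or.inl ⟨hf, fun h => hf' (h ▸ heq)⟩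
      · exact Or.inr ⟨hf, fun h => hf' (h ▸ heP)⟩
    have c1 := Set.ncard_le_ncard hsub
    have c2 := Set.ncard_union_le (pathsEdges (S : Set (PathSig G)) \ {e})
      ({e | e ∈ q.edges} \ {e})
    have c3 := Set.ncard_sdiff_singleton_add_one heP
    have c4 := Set.ncard_sdiff_singleton_add_one (s := {e | e ∈ q.edges}) heq
    rw [Nat.add_mul] at key
    omega
  · push Not at hmeet
    have hqM : IsAugPath M q := by
      refine (isAugPath_congr fun e x hx hxe => ?_).2 hq
      have : e ∉ pathsEdges (S : Set (PathSig G)) := by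
        rintro ⟨p, hp, hep⟩
        exact hmeet p hp x hx (SimpleGraph.Walk.mem_support_of_mem_edges hep hxe)
      simp [Set.mem_symmDiff, this]
    have hle := hmin u v q hqM
    have hne : q.length ≠ 2 * i + 1 := by
      intro hlen
      by_cases hqS : (⟨u, v, q⟩ : PathSig G) ∈ S
      · exact hmeet _ hqS u q.start_mem_support q.start_mem_support
      · obtain ⟨p, hp, hpq⟩ := hmax ⟨u, v, q⟩ hqM hlen hqS
        exact hpq (hmeet p hp)
    obtain ⟨m, hm⟩ := a3
    omega

/-- **Invariant of the global algorithm.** Let `M 0 = ∅` and, for `0 ≤ i ≤ k`, let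
`Pstar (i+1)` be any maximal collection of pairwise vertex-disjoint `M i`-augmenting
paths of length `2i+1`, and set `M (i+1) = M i ⊕ E(Pstar (i+1))`. Then for every
`0 ≤ i ≤ k+1`, the edge set `M i` is a matching in `G` and every `M i`-augmenting path
in `G` has length at least `2i + 1`. -/
theorem global_mcm_invariant {V : Type*} [Fintype V] [DecidableEq V]
    (G : SimpleGraph V) (k : ℕ)
    (M : ℕ → Set (Sym2 V)) (Pstar : ℕ → Set (PathSig G))
    (hM0 : M 0 = ∅)
    (hPaug : ∀ i ≤ k, ∀ p ∈ Pstar (i + 1),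
        IsAugPath (M i) p.2.2 ∧ p.2.2.length = 2 * i + 1)
    (hPdisj : ∀ i ≤ k, ∀ p ∈ Pstar (i + 1), ∀ q ∈ Pstar (i + 1), p ≠ q → VDisj p q)
    (hPmax : ∀ i ≤ k, ∀ q : PathSig G, IsAugPath (M i) q.2.2 →
        q.2.2.length = 2 * i + 1 → q ∉ Pstar (i + 1) →
        ∃ p ∈ Pstar (i + 1), ¬ VDisj q p)
    (hMstep : ∀ i ≤ k, M (i + 1) = symmDiff (M i) (pathsEdges (Pstar (i + 1)))) :
    ∀ i ≤ k + 1, IsEdgeMatching G (M i) ∧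
      ∀ (u v : V) (p : G.Walk u v), IsAugPath (M i) p → 2 * i + 1 ≤ p.length := by
  intro i
  induction i with
  | zero =>
    intro _
    refine ⟨by simp [hM0, IsEdgeMatching], fun u v p hp => ?_⟩
    have : p.length ≠ 0 := fun h => hp.2.1 (SimpleGraph.Walk.eq_of_length_eq_zero h)
    omega
  | succ i ih =>
    intro hi
    have hik : i ≤ k := by omega
    obtain ⟨hM, hmin⟩ := ih (by omega)
    rw [hMstep i hik]
    exact hM.augment_maximal hmin (hPaug i hik) (hPdisj i hik) (hPmax i hik)
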